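/- Let r ≥ 2 and n ≥ 4·r·log₂ n. Then for every n-vertex graph G there exists a set of at least (1/2)·(r−1)·log₂(n/2) vertices of G that contains no clique of size r, or contains no independent set of size r. Consequently, m_n(r) ≥ (1/2)·(r−1)·log₂(n/2) + 1, where m_n(r) is the minimum over n-vertex graphs G of the least m such that every m-subset contains both a clique and an independent set of size r. -/

import Mathlib

open Finset in
theorem lr_ramsey {V : Type*} [DecidableEq V] (G : SimpleGraph V) (m : ℕ) :
    ∀ (s t : ℕ) (S : Finset V), s + t = m → 2 ^ m ≤ S.card →
      (∃ K ⊆ S, G.IsNClique (s + 1) K) ∨ (∃ K ⊆ S, (Gᶜ).IsNClique (t + 1) K) := by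
  classical
  induction m with
  | zero =>
    intro s t S hst hS
    obtain ⟨v, hv⟩ : S.Nonempty := Finset.card_pos.mp (by simpa using hS)
    obtain rfl : s = 0 := by omega
    exact Or.inl ⟨{v}, by simpa using hv, by simp [SimpleGraph.isNClique_iff]⟩
  | succ m ih =>
    intro s t S hst hS
    have h2 : 0 < 2 ^ m := by positivity
    obtain ⟨v, hv⟩ : S.Nonempty := Finset.card_pos.mp (by omega)
    rcases s with _ | s
    · exact Or.inl ⟨{v}, by simpa using hv, by simp [SimpleGraph.isNClique_iff]⟩
    rcases t with _ | t
    · exact Or.inr ⟨{v}, by simpa using hv, by simp [SimpleGraph.isNClique_iff]⟩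
    have hc := Finset.card_filter_add_card_filter_not (s := S.erase v) (fun w => G.Adj v w)
    rw [Finset.card_erase_of_mem hv] at hc
    have hpow : 2 ^ (m + 1) = 2 * 2 ^ m := by ring
    by_cases hN : 2 ^ m ≤ ((S.erase v).filter (fun w => G.Adj v w)).card
    · rcases ih s (t + 1) _ (by omega) hN with ⟨K, hK, hc⟩ | ⟨K, hK, hc⟩
      · refine Or.inl ⟨insert v K, ?_, hc.insert ?_⟩
        · intro x hx
          rcases Finset.mem_insert.mp hx with rfl | hx
          · exact hv
          · have := hK hx
            simp at this
            exact this.1.2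
        · intro b hb
          have := hK hb
          simp at this
          exact this.2
      · exact Or.inr ⟨K, hK.trans ((Finset.filter_subset _ _).trans (Finset.erase_subset _ _)), hc⟩
    · have hM : 2 ^ m ≤ ((S.erase v).filter (fun w => ¬ G.Adj v w)).card := by omega
      rcases ih (s + 1) t _ (by omega) hM with ⟨K, hK, hc⟩ | ⟨K, hK, hc⟩
      · exact Or.inl ⟨K, hK.trans ((Finset.filter_subset _ _).trans (Finset.erase_subset _ _)), hc⟩
      · refine Or.inr ⟨insert v K, ?_, hc.insert ?_⟩
        · intro x hx
          rcases Finset.mem_insert.mp hx with rfl | hx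
          · exact hv
          · have := hK hx
            simp at this
            exact this.1.2
        · intro b hb
          have := hK hb
          simp at this
          rw [SimpleGraph.compl_adj]
          exact ⟨fun h => this.1.1 h.symm, this.2⟩

/-- `A` has `a * k` vertices and every set of pairwise `H`-non-adjacent vertices in `A`
has at most `a` elements. -/
def LRGood {V : Type*} (H : SimpleGraph V) (k a : ℕ) (A : Finset V) : Prop :=
  A.card = a * k ∧ ∀ K ⊆ A, (∀ x ∈ K, ∀ y ∈ K, x ≠ y → ¬ H.Adj x y) → K.card ≤ a

theorem LRGood.step {V : Type*} [DecidableEq V] {H : SimpleGraph V} {k a : ℕ} {A S : Finset V}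
    (hA : LRGood H k a A) (hS : H.IsNClique k S) (hd : Disjoint A S) :
    LRGood H k (a + 1) (A ∪ S) := by
  refine ⟨?_, ?_⟩
  · rw [Finset.card_union_of_disjoint hd, hA.1, hS.card_eq]; ring
  · intro K hK hind
    have h1 : (K ∩ A).card ≤ a := hA.2 _ Finset.inter_subset_right
      (fun x hx y hy => hind x (Finset.mem_inter.mp hx).1 y (Finset.mem_inter.mp hy).1)
    have h2 : (K ∩ S).card ≤ 1 := by
      rw [Finset.card_le_one]
      intro x hx y hy
      by_contra hne
      rw [Finset.mem_inter] at hx hy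
      exact hind x hx.1 y hy.1 hne (hS.isClique hx.2 hy.2 hne)
    have h3 : K = (K ∩ A) ∪ (K ∩ S) := by
      rw [← Finset.inter_union_distrib_left, Finset.inter_eq_left.mpr hK]
    calc K.card = ((K ∩ A) ∪ (K ∩ S)).card := by rw [← h3]
      _ ≤ _ := Finset.card_union_le _ _
      _ ≤ _ := by omega

theorem lr_extract {V : Type*} [Fintype V] [DecidableEq V] (G : SimpleGraph V) (j q : ℕ)
    (hbig : 2 ^ (j + j) + 2 * q * (j + 1) ≤ Fintype.card V) (t : ℕ) (ht : t ≤ 2 * q + 1) :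
    (∃ A, LRGood G (j + 1) (q + 1) A) ∨ (∃ B, LRGood Gᶜ (j + 1) (q + 1) B) ∨
    ∃ a b A B, a ≤ q ∧ b ≤ q ∧ a + b = t ∧ Disjoint A B ∧
      LRGood G (j + 1) a A ∧ LRGood Gᶜ (j + 1) b B := by
  induction t with
  | zero =>
    refine Or.inr (Or.inr ⟨0, 0, ∅, ∅, by omega, by omega, rfl, by simp, ?_, ?_⟩) <;>
    · refine ⟨by simp, fun K hK _ => ?_⟩
      simp [Finset.subset_empty.mp hK]
  | succ t ih =>
    rcases ih (by omega) with h | h | ⟨a, b, A, B, ha, hb, hab, hd, hA, hB⟩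
    · exact Or.inl h
    · exact Or.inr (Or.inl h)
    have hcard : 2 ^ (j + j) ≤ ((A ∪ B)ᶜ).card := by
      have h1 : (A ∪ B).card = t * (j + 1) := by
        rw [Finset.card_union_of_disjoint hd, hA.1, hB.1, ← hab]; ring
      have h2 : t * (j + 1) ≤ 2 * q * (j + 1) := Nat.mul_le_mul_right _ (by omega)
      rw [Finset.card_compl]
      omega
    rcases lr_ramsey G (j + j) j j _ rfl hcard with ⟨S, hS, hc⟩ | ⟨S, hS, hc⟩
    · have hdS : Disjoint (A ∪ B) S :=
        (Finset.disjoint_left.mpr fun x hx hxS => (Finset.mem_compl.mp (hS hxS)) hx)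
      rw [Finset.disjoint_union_left] at hdS
      have := hA.step hc hdS.1
      by_cases hq : a = q
      · subst hq; exact Or.inl ⟨_, this⟩
      · exact Or.inr (Or.inr ⟨a + 1, b, A ∪ S, B, by omega, hb, by omega,
          Finset.disjoint_union_left.mpr ⟨hd, hdS.2.symm⟩, this, hB⟩)
    · have hdS : Disjoint (A ∪ B) S :=
        (Finset.disjoint_left.mpr fun x hx hxS => (Finset.mem_compl.mp (hS hxS)) hx)
      rw [Finset.disjoint_union_left] at hdS
      have := hB.step hc hdS.2
      by_cases hq : b = q
      · subst hq; exact Or.inr (Or.inl ⟨_, this⟩)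
      · exact Or.inr (Or.inr ⟨a, b + 1, A, B ∪ S, ha, by omega, by omega,
          Finset.disjoint_union_right.mpr ⟨hd, hdS.1⟩, hA, this⟩)

theorem lr_first {V : Type*} [Fintype V] (n r : ℕ)
    (hn : Fintype.card V = n) (hr : 2 ≤ r)
    (hnr : (4 * r : ℝ) * Real.logb 2 n ≤ (n : ℝ)) (G : SimpleGraph V) :
    (∃ A : Finset V,
      (1 / 2 : ℝ) * ((r : ℝ) - 1) * Real.logb 2 ((n : ℝ) / 2) ≤ (A.card : ℝ) ∧
      ((¬ ∃ K ⊆ A, G.IsNClique r K) ∨ (¬ ∃ K ⊆ A, (Gᶜ).IsNClique r K))) := by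
  classical
  have hr' : (2 : ℝ) ≤ r := by exact_mod_cast hr
  by_cases hlog : Real.logb 2 ((n : ℝ) / 2) ≤ 0
  · refine ⟨∅, ?_, Or.inl ?_⟩
    · have : (0 : ℝ) ≤ 1 / 2 * ((r : ℝ) - 1) := by linarith
      simpa using mul_nonpos_of_nonneg_of_nonpos this hlog
    · rintro ⟨K, hK, hc⟩
      have := hc.card_eq
      rw [Finset.subset_empty.mp hK] at this
      simp at this
      omega
  push Not at hlog
  have hn0 : (n : ℝ) ≠ 0 := by
    intro h
    simp [h] at hlog
  have hnpos : (0 : ℝ) < n := lt_of_le_of_ne (Nat.cast_nonneg n) hn0.symm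
  have hsplit : Real.logb 2 ((n : ℝ) / 2) = Real.logb 2 n - 1 := by
    rw [Real.logb_div hn0 (by norm_num), Real.logb_self_eq_one (by norm_num)]
  set L := Real.logb 2 (n : ℝ) with hL
  set x : ℝ := 1 / 2 * Real.logb 2 ((n : ℝ) / 2) with hx
  have hxpos : 0 < x := by positivity
  obtain ⟨j, hj⟩ : ∃ j, ⌈x⌉₊ = j + 1 :=
    Nat.exists_eq_succ_of_ne_zero (Nat.ceil_pos.mpr hxpos).ne'
  have hjx : (j : ℝ) < x := Nat.lt_ceil.mp (by omega)
  have hxj : x ≤ (j : ℝ) + 1 := by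
    have := Nat.le_ceil x
    rw [hj] at this
    exact_mod_cast this
  obtain ⟨q, rfl⟩ : ∃ q, r = q + 2 := ⟨r - 2, by omega⟩
  have hpow : (2 : ℝ) ^ (j + j) ≤ n / 2 := by
    rw [← Real.rpow_natCast, ← Real.le_logb_iff_rpow_le (by norm_num) (by positivity)]
    push_cast
    linarith
  have hq0 : (0 : ℝ) ≤ q := Nat.cast_nonneg q
  push_cast at hnr
  have hqj : 2 * (q : ℝ) * (j + 1) ≤ n / 2 := by
    have h1 : 2 * ((j : ℝ) + 1) ≤ L + 1 := by linarith
    have h2 : (q : ℝ) * (2 * ((j : ℝ) + 1)) ≤ q * (L + 1) := mul_le_mul_of_nonneg_left h1 hq0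
    have h3 : (q : ℝ) * 1 ≤ q * L := mul_le_mul_of_nonneg_left (by linarith) hq0
    nlinarith
  have hbig : 2 ^ (j + j) + 2 * q * (j + 1) ≤ Fintype.card V := by
    rw [hn]
    have : ((2 ^ (j + j) + 2 * q * (j + 1) : ℕ) : ℝ) ≤ n := by
      push_cast
      linarith
    exact_mod_cast this
  have hsize : (1 / 2 : ℝ) * (((q + 2 : ℕ) : ℝ) - 1) * Real.logb 2 ((n : ℝ) / 2) ≤
      (((q + 1) * (j + 1) : ℕ) : ℝ) := by
    push_cast
    have := mul_le_mul_of_nonneg_left hxj (by positivity : (0 : ℝ) ≤ q + 1)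
    rw [hx] at this
    linarith
  rcases lr_extract G j q hbig (2 * q + 1) le_rfl with ⟨A, hA⟩ | ⟨B, hB⟩ |
    ⟨a, b, A, B, ha, hb, hab, _⟩
  · refine ⟨A, by rw [hA.1]; exact hsize, Or.inr ?_⟩
    rintro ⟨K, hK, hc⟩
    have := hA.2 K hK (fun x hx y hy hne =>
      ((SimpleGraph.compl_adj _ _ _).mp (hc.isClique hx hy hne)).2)
    rw [hc.card_eq] at this
    omega
  · refine ⟨B, by rw [hB.1]; exact hsize, Or.inl ?_⟩
    rintro ⟨K, hK, hc⟩
    have := hB.2 K hK (fun x hx y hy hne h =>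
      ((SimpleGraph.compl_adj _ _ _).mp h).2 (hc.isClique hx hy hne))
    rw [hc.card_eq] at this
    omega
  · omega


/-- Lower bound (Proposition 4.1): if `r ≥ 2` and `n ≥ 4·r·log₂ n`, then every
`n`-vertex graph `G` has a set of at least `(1/2)·(r−1)·log₂(n/2)` vertices that
contains no clique of size `r` or contains no independent set of size `r`;
consequently the least `m` such that every `m`-subset of `G` contains both a clique
and an independent set of size `r` is at least `(1/2)·(r−1)·log₂(n/2) + 1`. -/
theorem locally_ramsey_lower_bound {V : Type*} [Fintype V] (n r : ℕ)
    (hn : Fintype.card V = n) (hr : 2 ≤ r)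
    (hnr : (4 * r : ℝ) * Real.logb 2 n ≤ (n : ℝ)) (G : SimpleGraph V) :
    (∃ A : Finset V,
      (1 / 2 : ℝ) * ((r : ℝ) - 1) * Real.logb 2 ((n : ℝ) / 2) ≤ (A.card : ℝ) ∧
      ((¬ ∃ K ⊆ A, G.IsNClique r K) ∨ (¬ ∃ K ⊆ A, (Gᶜ).IsNClique r K))) ∧
    (1 / 2 : ℝ) * ((r : ℝ) - 1) * Real.logb 2 ((n : ℝ) / 2) + 1 ≤
      ((sInf {m : ℕ | ∀ A : Finset V, m ≤ A.card →
        (∃ K ⊆ A, G.IsNClique r K) ∧ (∃ K ⊆ A, (Gᶜ).IsNClique r K)} : ℕ) : ℝ) := by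
  obtain ⟨A, hA, hfree⟩ := lr_first n r hn hr hnr G
  refine ⟨⟨A, hA, hfree⟩, ?_⟩
  set M := {m : ℕ | ∀ A : Finset V, m ≤ A.card →
        (∃ K ⊆ A, G.IsNClique r K) ∧ (∃ K ⊆ A, (Gᶜ).IsNClique r K)} with hM
  have hne : M.Nonempty := by
    refine ⟨Fintype.card V + 1, fun B hB => ?_⟩
    have := Finset.card_le_univ B
    omega
  have hmem : sInf M ∈ M := Nat.sInf_mem hne
  have hlt : A.card + 1 ≤ sInf M := by
    by_contra hcon
    have h := hmem A (by omega)
    rcases hfree with hf | hf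
    · exact hf h.1
    · exact hf h.2
  have : ((A.card : ℝ) + 1) ≤ ((sInf M : ℕ) : ℝ) := by exact_mod_cast hlt
  linarith
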